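/- arXiv:1410.2882 — 6 statements merged into one kernel-verified Lean document; each statement's English description precedes it below -/
import Mathlib

section
/- Let d ≥ 1 and let v ∈ ℂ^d be any vector. Then there exists a nonempty subset S ⊆ {1, …, d} such that (1/√|S|) · |∑_{j ∈ S} v_j| ≥ ‖v‖₂ / (8 · √(log₂(d) + 3)). -/
open scoped BigOperators

lemma geo_aux {ι : Type*} [DecidableEq ι] (a : ι → ℝ) (ha : ∀ i, 0 ≤ a i) (M : ℝ)
    (h : ∀ S : Finset ι, (∑ j ∈ S, a j) ^ 2 ≤ M * S.card) (T : Finset ι) :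
    ∑ j ∈ T, a j ^ 2 ≤ M * (harmonic T.card : ℝ) := by
  induction T using Finset.induction_on_min_value a with
  | empty => simp
  | insert m s hm hmin ih =>
    have h1 := h (insert m s)
    rw [Finset.sum_insert hm, Finset.card_insert_of_notMem hm] at h1 ⊢
    rw [harmonic_succ]
    have h2 : (s.card : ℝ) * a m ≤ ∑ j ∈ s, a j := by
      have := Finset.card_nsmul_le_sum s a (a m) hmin
      simpa using this
    push_cast at h1 ⊢
    have hp : (0 : ℝ) < s.card + 1 := by positivity
    have h3 : ((s.card + 1 : ℝ) * a m) ^ 2 ≤ M * (s.card + 1) := by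
      refine le_trans ?_ h1
      have := ha m
      apply pow_le_pow_left₀ (by positivity)
      linarith
    have h4 : a m ^ 2 ≤ M * (s.card + 1 : ℝ)⁻¹ := by
      rw [← div_eq_mul_inv, le_div_iff₀ hp]
      have : (a m ^ 2 * (s.card + 1 : ℝ)) * (s.card + 1) ≤ M * (s.card + 1) := by
        linarith [h3, mul_pow (s.card + 1 : ℝ) (a m) 2]
      exact le_of_mul_le_mul_right this hp
    linarith

lemma geo_part {d : ℕ} (v : Fin d → ℂ) (M : ℝ) (hM : 0 ≤ M)
    (h : ∀ S : Finset (Fin d), ‖∑ j ∈ S, v j‖ ^ 2 ≤ M * S.card) (w : ℂ) (hw : ‖w‖ = 1) :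
    ∑ j, (max (w * v j).re 0) ^ 2 ≤ M * (harmonic d : ℝ) := by
  have := geo_aux (fun j => max (w * v j).re 0) (fun _ => le_max_right _ _) M ?_ Finset.univ
  · simpa using this
  intro S
  have e : ∑ j ∈ S, max (w * v j).re 0
      = (w * ∑ j ∈ S.filter (fun j => 0 < (w * v j).re), v j).re := by
    rw [Finset.mul_sum, Complex.re_sum, Finset.sum_filter]
    refine Finset.sum_congr rfl fun j _ => ?_
    split_ifs with hj
    · exact max_eq_left hj.le
    · exact max_eq_right (not_lt.mp hj)
  have h0 : 0 ≤ ∑ j ∈ S, max (w * v j).re 0 :=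
    Finset.sum_nonneg fun _ _ => le_max_right _ _
  calc (∑ j ∈ S, max (w * v j).re 0) ^ 2
      ≤ ‖∑ j ∈ S.filter (fun j => 0 < (w * v j).re), v j‖ ^ 2 := by
        apply pow_le_pow_left₀ h0
        rw [e]
        refine (Complex.re_le_norm _).trans ?_
        rw [norm_mul, hw, one_mul]
    _ ≤ _ := h _
    _ ≤ M * S.card := by
        gcongr
        exact Finset.filter_subset _ _

/-- **Geometric Lemma** (complex version): for any vector `v ∈ ℂ^d` there is a nonempty
subset `S ⊆ [d]` with `(1/√|S|)·|∑_{j∈S} v_j| ≥ ‖v‖₂ / (8·√(log₂ d + 3))`. -/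
theorem geometric_lemma (d : ℕ) (hd : 1 ≤ d) (v : Fin d → ℂ) :
    ∃ S : Finset (Fin d), S.Nonempty ∧
      (1 / Real.sqrt S.card) * ‖∑ j ∈ S, v j‖ ≥
        Real.sqrt (∑ j, ‖v j‖ ^ 2) / (8 * Real.sqrt (Real.logb 2 d + 3)) := by
  by_contra! hcon
  have hd1 : (1 : ℝ) ≤ d := by exact_mod_cast hd
  have hlog : 0 ≤ Real.log d := Real.log_nonneg hd1
  have hlogb : Real.log d ≤ Real.logb 2 d := by
    rw [Real.logb, le_div_iff₀ (Real.log_pos (by norm_num))]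
    have := Real.log_two_lt_d9
    nlinarith
  set L := Real.logb 2 d + 3 with hL
  set N := ∑ j, ‖v j‖ ^ 2 with hN
  have hN0 : 0 ≤ N := Finset.sum_nonneg fun _ _ => by positivity
  have hLpos : 0 < L := by linarith
  have hc : (Real.sqrt N / (8 * Real.sqrt L)) ^ 2 = N / (64 * L) := by
    rw [div_pow, mul_pow, Real.sq_sqrt hN0, Real.sq_sqrt hLpos.le]; norm_num
  have hNpos : 0 < N := by
    rcases hN0.lt_or_eq with h | h
    · exact h
    · exfalso
      have := hcon {⟨0, hd⟩} (by simp)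
      rw [← h] at this
      simp at this
      linarith [norm_nonneg (v ⟨0, hd⟩)]
  have hS : ∀ S : Finset (Fin d), ‖∑ j ∈ S, v j‖ ^ 2 ≤ N / (64 * L) * S.card := by
    intro S
    rcases S.eq_empty_or_nonempty with rfl | hne
    · simp
    have hcp : (0 : ℝ) < S.card := by exact_mod_cast hne.card_pos
    have h1 := hcon S hne
    have h2 := pow_le_pow_left₀ (by positivity) h1.le 2
    rw [hc, mul_pow, div_pow, Real.sq_sqrt hcp.le, one_pow, one_div, inv_mul_le_iff₀ hcp] at h2
    linarith
  have hM : 0 ≤ N / (64 * L) := by positivity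
  have p1 := geo_part v _ hM hS 1 (by simp)
  have p2 := geo_part v _ hM hS (-1) (by simp)
  have p3 := geo_part v _ hM hS Complex.I (by simp)
  have p4 := geo_part v _ hM hS (-Complex.I) (by simp)
  have key : ∀ x : ℝ, x ^ 2 = max x 0 ^ 2 + max (-x) 0 ^ 2 := by
    intro x
    rcases le_total x 0 with h | h
    · rw [max_eq_right h, max_eq_left (by linarith)]; ring
    · rw [max_eq_left h, max_eq_right (by linarith)]; ring
  have hsum : N = ∑ j, (max (1 * v j).re 0) ^ 2 + ∑ j, (max (-1 * v j).re 0) ^ 2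
      + ∑ j, (max (Complex.I * v j).re 0) ^ 2 + ∑ j, (max (-Complex.I * v j).re 0) ^ 2 := by
    rw [hN, ← Finset.sum_add_distrib, ← Finset.sum_add_distrib, ← Finset.sum_add_distrib]
    refine Finset.sum_congr rfl fun j _ => ?_
    have k1 := key (v j).re
    have k2 := key (v j).im
    rw [Complex.sq_norm, Complex.normSq_apply]
    simp
    linarith
  have hH : (harmonic d : ℝ) ≤ L := by
    have := harmonic_le_one_add_log d
    linarith
  have h5 : N / (64 * L) * (harmonic d : ℝ) ≤ N / (64 * L) * L := by gcongr
  have h6 : N / (64 * L) * L = N / 64 := by field_simp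
  linarith
end

section
/- For every n ≥ 1 and every unit vector ψ ∈ ℂ^{2^n}, there exists a nonempty subset S ⊆ {1, …, 2^n} such that |⟨S, ψ⟩| ≥ 1 / (8 · √(n + 3)), where ⟨·,·⟩ is the standard Hermitian inner product on ℂ^{2^n}. -/
open scoped BigOperators

/-- The subset state `|S⟩ ∈ ℂ^d` for a subset `S ⊆ [d]`: the uniform superposition
over the elements of `S` (coordinate `1/√|S|` on `S`, and `0` elsewhere). -/
noncomputable def subsetState {d : ℕ} (S : Finset (Fin d)) : Fin d → ℂ :=
  fun i => if i ∈ S then ((1 / Real.sqrt S.card : ℝ) : ℂ) else 0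

lemma aux_sq {ι : Type*} [DecidableEq ι] (a : ι → ℝ) (c : ℝ) (k : ℕ) :
    ∀ T : Finset ι, T.card = k → (∀ i ∈ T, 0 ≤ a i) →
      (∀ U ⊆ T, ∑ i ∈ U, a i ≤ c * Real.sqrt U.card) →
      ∑ i ∈ T, a i ^ 2 ≤ c ^ 2 * (harmonic k : ℝ) := by
  induction k with
  | zero =>
    intro T hT _ _
    rw [Finset.card_eq_zero] at hT
    subst hT
    simp
  | succ k ih =>
    intro T hT hpos hU
    have hne : T.Nonempty := by
      rw [← Finset.card_pos]; omega
    obtain ⟨m, hm, hmin⟩ := Finset.exists_min_image T a hne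
    have h1 := ih (T.erase m) (by rw [Finset.card_erase_of_mem hm]; omega)
      (fun i hi => hpos i (Finset.mem_of_mem_erase hi))
      (fun U hUT => hU U (hUT.trans (Finset.erase_subset _ _)))
    rw [← Finset.add_sum_erase T _ hm, harmonic_succ]
    have h2 : ((k + 1 : ℕ) : ℝ) * a m ≤ c * Real.sqrt ((k + 1 : ℕ) : ℝ) := by
      have h3 := hU T subset_rfl
      have h4 := Finset.card_nsmul_le_sum T a (a m) hmin
      rw [hT] at h3 h4
      rw [nsmul_eq_mul] at h4
      exact h4.trans h3
    have hk : (0 : ℝ) < ((k + 1 : ℕ) : ℝ) := by positivity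
    have h5 : (((k + 1 : ℕ) : ℝ) * a m) ^ 2 ≤ c ^ 2 * ((k + 1 : ℕ) : ℝ) := by
      have := pow_le_pow_left₀ (mul_nonneg hk.le (hpos m hm)) h2 2
      rwa [mul_pow c, Real.sq_sqrt hk.le] at this
    have h6 : a m ^ 2 ≤ c ^ 2 * (((k + 1 : ℕ) : ℝ))⁻¹ := by
      rw [← div_eq_mul_inv, le_div_iff₀ hk]
      nlinarith
    push_cast at h6 ⊢
    linarith

lemma aux_half (n : ℕ) (a : Fin (2 ^ n) → ℝ) (c : ℝ)
    (h : ∀ U : Finset (Fin (2 ^ n)), |∑ i ∈ U, a i| ≤ c * Real.sqrt U.card) :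
    ∑ i, a i ^ 2 ≤ 2 * (c ^ 2 * (n + 1)) := by
  have hh : ∀ T : Finset (Fin (2 ^ n)), (harmonic T.card : ℝ) ≤ n + 1 := by
    intro T
    have h1 := harmonic_le_one_add_log T.card
    have h2 : T.card ≤ 2 ^ n := by simpa using T.card_le_univ
    rcases Nat.eq_zero_or_pos T.card with h0 | h0
    · rw [h0]; simp; positivity
    have h3 : Real.log T.card ≤ Real.log ((2 : ℝ) ^ n) :=
      Real.log_le_log (by exact_mod_cast h0) (by exact_mod_cast h2)
    rw [Real.log_pow] at h3
    have h4 : Real.log 2 ≤ 1 := by linarith [Real.log_two_lt_d9]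
    have h5 : (n : ℝ) * Real.log 2 ≤ n * 1 := by gcongr
    linarith
  have key : ∀ T : Finset (Fin (2 ^ n)), c ^ 2 * (harmonic T.card : ℝ) ≤ c ^ 2 * (n + 1) :=
    fun T => mul_le_mul_of_nonneg_left (hh T) (sq_nonneg c)
  rw [← Finset.sum_filter_add_sum_filter_not Finset.univ (fun i => 0 ≤ a i)]
  have p := aux_sq a c _ (Finset.univ.filter (fun i => 0 ≤ a i)) rfl (by simp)
    (fun U _ => (le_abs_self _).trans (h U))
  have q := aux_sq (fun i => - a i) c _ (Finset.univ.filter (fun i => ¬ 0 ≤ a i)) rfl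
    (by intro i hi; simp at hi; simpa using hi.le)
    (fun U _ => by
      rw [Finset.sum_neg_distrib]
      exact (neg_le_abs _).trans (h U))
  simp only [neg_sq] at q
  linarith [key (Finset.univ.filter (fun i => 0 ≤ a i)),
    key (Finset.univ.filter (fun i => ¬ 0 ≤ a i))]

/-- **Subset State Approximation Lemma**: every `n`-qubit unit vector `ψ` has overlap
at least `1/(8√(n+3))` with some subset state. -/
theorem subset_state_approximation (n : ℕ) (hn : 1 ≤ n) (ψ : Fin (2 ^ n) → ℂ)
    (hψ : ∑ i, ‖ψ i‖ ^ 2 = 1) :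
    ∃ S : Finset (Fin (2 ^ n)), S.Nonempty ∧
      ‖∑ i, (starRingEnd ℂ) (subsetState S i) * ψ i‖ ≥
        1 / (8 * Real.sqrt (n + 3)) := by
  by_contra! hcon
  set c : ℝ := 1 / (8 * Real.sqrt (n + 3)) with hc
  have hU : ∀ U : Finset (Fin (2 ^ n)), ‖∑ i ∈ U, ψ i‖ ≤ c * Real.sqrt U.card := by
    intro U
    rcases U.eq_empty_or_nonempty with rfl | hne
    · simp
    have h1 := hcon U hne
    have hs : 0 < Real.sqrt U.card := Real.sqrt_pos.mpr (by exact_mod_cast hne.card_pos)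
    have h2 : ∑ i, (starRingEnd ℂ) (subsetState U i) * ψ i
        = ((1 / Real.sqrt U.card : ℝ) : ℂ) * ∑ i ∈ U, ψ i := by
      rw [Finset.mul_sum, ← Finset.sum_filter_add_sum_filter_not Finset.univ (fun i => i ∈ U)]
      rw [Finset.sum_eq_zero (s := Finset.univ.filter (fun i => ¬ i ∈ U)), add_zero,
        Finset.filter_univ_mem]
      · refine Finset.sum_congr rfl fun i hi => ?_
        rw [subsetState, if_pos hi, Complex.conj_ofReal]
      · intro i hi
        simp at hi
        simp [subsetState, hi]
    rw [h2, norm_mul, Complex.norm_real, Real.norm_of_nonneg (by positivity),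
      one_div_mul_eq_div, div_lt_iff₀ hs] at h1
    exact h1.le
  have hre := aux_half n (fun i => (ψ i).re) c (fun U => by
    rw [← Complex.re_sum]; exact (Complex.abs_re_le_norm _).trans (hU U))
  have him := aux_half n (fun i => (ψ i).im) c (fun U => by
    rw [← Complex.im_sum]; exact (Complex.abs_im_le_norm _).trans (hU U))
  have htot : ∑ i, ‖ψ i‖ ^ 2 = ∑ i, (ψ i).re ^ 2 + ∑ i, (ψ i).im ^ 2 := by
    rw [← Finset.sum_add_distrib]
    refine Finset.sum_congr rfl fun i _ => ?_
    rw [Complex.sq_norm, Complex.normSq_apply]; ring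
  have hn3 : (0 : ℝ) < n + 3 := by positivity
  have hc2 : c ^ 2 * (n + 3) = 1 / 64 := by
    rw [hc, div_pow, mul_pow, Real.sq_sqrt hn3.le]
    field_simp
    norm_num
  nlinarith [sq_nonneg c]
end

section
/- For every n ≥ 1 and every unit vector ψ ∈ ℂ^{2^n}, there exists a nonempty subset S ⊆ {1, …, 2^n} whose cardinality |S| is a power of 2 and such that |⟨S, ψ⟩| ≥ 1 / (16 · √(n + 3)), where ⟨·,·⟩ is the standard Hermitian inner product on ℂ^{2^n}. -/
open scoped BigOperators

lemma exists_top {α : Type*} [DecidableEq α] (a : α → ℝ) (P : Finset α) (k : ℕ) (hk : k ≤ P.card) :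
    ∃ T ⊆ P, T.card = k ∧ ∀ i ∈ T, ∀ j ∈ P \ T, a j ≤ a i := by
  induction k with
  | zero => exact ⟨∅, by simp, by simp, by simp⟩
  | succ k ih =>
    obtain ⟨T, hT, hc, h⟩ := ih (by omega)
    have hne : (P \ T).Nonempty := by
      rw [← Finset.card_pos, Finset.card_sdiff_of_subset hT]; omega
    obtain ⟨x, hx, hmax⟩ := Finset.exists_max_image (P \ T) a hne
    have hx' := Finset.mem_sdiff.1 hx
    refine ⟨insert x T, Finset.insert_subset hx'.1 hT, ?_, ?_⟩
    · rw [Finset.card_insert_of_notMem hx'.2, hc]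
    · intro i hi j hj
      have hj' : j ∈ P \ T := by
        simp only [Finset.mem_sdiff, Finset.mem_insert, not_or] at hj ⊢
        exact ⟨hj.1, hj.2.2⟩
      rcases Finset.mem_insert.1 hi with rfl | hi
      · exact hmax j hj'
      · exact h i hi j hj'

lemma sum_sq_bound {α : Type*} [DecidableEq α] (a : α → ℝ) (D : ℝ) (hD : 0 ≤ D) (m : ℕ) :
    ∀ P : Finset α, P.card < 2 ^ m → (∀ i ∈ P, 0 ≤ a i) →
      (∀ S ⊆ P, ∀ t : ℕ, S.card = 2 ^ t → (∑ i ∈ S, a i) ^ 2 ≤ D * S.card) →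
      ∑ i ∈ P, a i ^ 2 ≤ m * D := by
  induction m with
  | zero =>
    intro P hP _ _
    have : P = ∅ := by
      rw [← Finset.card_eq_zero]; simpa using hP
    simp [this]
  | succ m ih =>
    intro P hP h0 hS
    by_cases hlt : P.card < 2 ^ m
    · have := ih P hlt h0 hS
      push_cast
      linarith
    have hpos : 0 < 2 ^ m := by positivity
    obtain ⟨T, hT, hc, htop⟩ := exists_top a P (2 ^ m - 1) (by omega)
    have h1 := ih T (by omega) (fun i hi => h0 i (hT hi)) (fun S hs => hS S (hs.trans hT))
    have hR : (P \ T).card ≤ 2 ^ m := by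
      rw [Finset.card_sdiff_of_subset hT, hc]
      rw [pow_succ] at hP
      omega
    have hposR : (0 : ℝ) < 2 ^ m := by positivity
    have h2 : ∀ i ∈ P \ T, a i ^ 2 ≤ D / 2 ^ m := by
      intro i hi
      have hi' := Finset.mem_sdiff.1 hi
      have hcard : (insert i T).card = 2 ^ m := by
        rw [Finset.card_insert_of_notMem hi'.2, hc]; omega
      have h3 := hS (insert i T) (Finset.insert_subset hi'.1 hT) m hcard
      have h4 : (insert i T).card • a i ≤ ∑ j ∈ insert i T, a j := by
        apply Finset.card_nsmul_le_sum
        intro j hj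
        rcases Finset.mem_insert.1 hj with rfl | hj
        · exact le_rfl
        · exact htop j hj i hi
      rw [hcard] at h3 h4
      rw [nsmul_eq_mul] at h4
      push_cast at h3 h4
      have h5 : (2 ^ m * a i) ^ 2 ≤ D * 2 ^ m :=
        (pow_le_pow_left₀ (mul_nonneg hposR.le (h0 i hi'.1)) h4 2).trans h3
      rw [le_div_iff₀ hposR]
      have h6 : (a i ^ 2 * 2 ^ m) * 2 ^ m ≤ D * 2 ^ m := by
        calc _ = (2 ^ m * a i) ^ 2 := by ring
          _ ≤ _ := h5
      exact le_of_mul_le_mul_right h6 hposR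
    have h7 : ∑ i ∈ P \ T, a i ^ 2 ≤ D := by
      have h8 := Finset.sum_le_card_nsmul (P \ T) (fun i => a i ^ 2) _ h2
      rw [nsmul_eq_mul] at h8
      have h9 : ((P \ T).card : ℝ) ≤ 2 ^ m := by exact_mod_cast hR
      calc _ ≤ _ := h8
        _ ≤ 2 ^ m * (D / 2 ^ m) := by gcongr
        _ = D := by field_simp
    rw [← Finset.sum_sdiff hT]
    push_cast
    linarith

/-- Subset State Approximation with subset size a power of two: every `n`-qubit unit
vector `ψ` has overlap at least `1/(16√(n+3))` with some subset state whose subset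
has cardinality a power of `2`. -/
theorem subset_state_approximation_pow_two (n : ℕ) (hn : 1 ≤ n) (ψ : Fin (2 ^ n) → ℂ)
    (hψ : ∑ i, ‖ψ i‖ ^ 2 = 1) :
    ∃ S : Finset (Fin (2 ^ n)), S.Nonempty ∧ (∃ t : ℕ, S.card = 2 ^ t) ∧
      ‖∑ i, (starRingEnd ℂ) (subsetState S i) * ψ i‖ ≥
        1 / (16 * Real.sqrt (n + 3)) := by
  by_contra hcon
  push Not at hcon
  set D : ℝ := 1 / (256 * (n + 3)) with hDdef
  have hD : 0 ≤ D := by positivity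
  have key : ∀ S : Finset (Fin (2 ^ n)), ∀ t : ℕ, S.card = 2 ^ t →
      ‖∑ i ∈ S, ψ i‖ ^ 2 ≤ D * S.card := by
    intro S t ht
    have hcp : 0 < S.card := by rw [ht]; positivity
    have hcpR : (0 : ℝ) < S.card := by exact_mod_cast hcp
    have h := hcon S (Finset.card_pos.1 hcp) ⟨t, ht⟩
    have heq : ∑ i, (starRingEnd ℂ) (subsetState S i) * ψ i
        = ((1 / Real.sqrt S.card : ℝ) : ℂ) * ∑ i ∈ S, ψ i := by
      rw [Finset.mul_sum, ← Finset.sum_filter_add_sum_filter_not Finset.univ (· ∈ S)]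
      rw [Finset.sum_eq_zero (s := Finset.univ.filter (fun i => ¬ i ∈ S))]
      · rw [add_zero, Finset.filter_univ_mem]
        apply Finset.sum_congr rfl
        intro i hi
        simp only [subsetState, if_pos hi, Complex.conj_ofReal]
      · intro i hi
        have hi' := (Finset.mem_filter.1 hi).2
        simp [subsetState, hi']
    rw [heq, norm_mul, Complex.norm_real, Real.norm_of_nonneg (by positivity)] at h
    have h2 := pow_le_pow_left₀ (by positivity) h.le 2
    rw [mul_pow, div_pow, div_pow, mul_pow, Real.sq_sqrt hcpR.le,
      Real.sq_sqrt (by positivity)] at h2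
    have h3 : ‖∑ i ∈ S, ψ i‖ ^ 2 / S.card ≤ D := by
      calc _ = 1 ^ 2 / (S.card : ℝ) * ‖∑ i ∈ S, ψ i‖ ^ 2 := by ring
        _ ≤ _ := h2
        _ = D := by rw [hDdef]; norm_num
    rwa [div_le_iff₀ hcpR] at h3
  have main : ∀ a : Fin (2 ^ n) → ℝ,
      (∀ S : Finset (Fin (2 ^ n)), |∑ i ∈ S, a i| ≤ ‖∑ i ∈ S, ψ i‖) →
      ∑ i ∈ Finset.univ.filter (fun i => 0 ≤ a i), a i ^ 2 ≤ ((n + 1 : ℕ) : ℝ) * D := by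
    intro a ha
    apply sum_sq_bound a D hD
    · calc _ ≤ (Finset.univ : Finset (Fin (2 ^ n))).card := Finset.card_filter_le _ _
        _ = 2 ^ n := by simp
        _ < 2 ^ (n + 1) := Nat.pow_lt_pow_right (by norm_num) (by omega)
    · intro i hi
      exact (Finset.mem_filter.1 hi).2
    · intro S _ t ht
      rw [← sq_abs]
      exact (pow_le_pow_left₀ (abs_nonneg _) (ha S) 2).trans (key S t ht)
  have main2 : ∀ a : Fin (2 ^ n) → ℝ,
      (∀ S : Finset (Fin (2 ^ n)), |∑ i ∈ S, a i| ≤ ‖∑ i ∈ S, ψ i‖) →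
      ∑ i, a i ^ 2 ≤ 2 * (((n + 1 : ℕ) : ℝ) * D) := by
    intro a ha
    have h1 := main a ha
    have h2 := main (fun i => - a i) (by
      intro S
      rw [Finset.sum_neg_distrib, abs_neg]
      exact ha S)
    rw [Finset.sum_filter] at h1 h2
    have h3 : ∑ i, a i ^ 2 ≤ ∑ i, ((if 0 ≤ a i then a i ^ 2 else 0) +
        (if 0 ≤ - a i then (- a i) ^ 2 else 0)) := by
      apply Finset.sum_le_sum
      intro i _
      have := sq_nonneg (a i)
      split_ifs <;> first | nlinarith | (exfalso; linarith)
    rw [Finset.sum_add_distrib] at h3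
    linarith
  have hre := main2 (fun i => (ψ i).re) (by
    intro S; rw [← Complex.re_sum]; exact Complex.abs_re_le_norm _)
  have him := main2 (fun i => (ψ i).im) (by
    intro S; rw [← Complex.im_sum]; exact Complex.abs_im_le_norm _)
  have hsum : ∑ i, ‖ψ i‖ ^ 2 = ∑ i, (ψ i).re ^ 2 + ∑ i, (ψ i).im ^ 2 := by
    rw [← Finset.sum_add_distrib]
    apply Finset.sum_congr rfl
    intro i _
    rw [Complex.sq_norm, Complex.normSq_apply]; ring
  have hfin : ((n + 1 : ℕ) : ℝ) * D ≤ 1 / 256 := by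
    rw [hDdef, mul_one_div, div_le_div_iff₀ (by positivity) (by norm_num)]
    push_cast
    linarith
  linarith
end

section
/- Let v, w ∈ ℂ^d be unit vectors. Then the maximum of |Tr(C · (vv* − ww*))| over all d × d complex matrices C with 0 ≼ C ≼ I equals (1/2) · ‖ vv* − ww* ‖₁. In particular, for every C with 0 ≼ C ≼ I, |Tr(C · (vv* − ww*))| ≤ √(1 − |⟨v, w⟩|²), and this bound is attained by some such C. -/
open scoped BigOperators ComplexOrder
open Matrix

/-- The positive semidefinite square root of a positive semidefinite matrix (the definition
of the older Mathlib, which is no longer there). -/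
noncomputable def Matrix.PosSemidef.sqrt {n 𝕜 : Type*} [Fintype n] [RCLike 𝕜] [DecidableEq n]
    {A : Matrix n n 𝕜} (hA : A.PosSemidef) : Matrix n n 𝕜 :=
  hA.1.eigenvectorUnitary.1 * diagonal ((↑) ∘ Real.sqrt ∘ hA.1.eigenvalues) *
    (star hA.1.eigenvectorUnitary : Matrix n n 𝕜)

/-- The trace norm `‖A‖₁ = Tr √(AᴴA)` of a complex square matrix (the sum of its
singular values). -/
noncomputable def traceNorm {d : ℕ} (A : Matrix (Fin d) (Fin d) ℂ) : ℝ :=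
  ((Matrix.posSemidef_conjTranspose_mul_self A).sqrt.trace).re

/-- The rank-one projection `|v⟩⟨v|`, with entries `v_i · conj (v_j)`. -/
def outerProj {d : ℕ} (v : Fin d → ℂ) : Matrix (Fin d) (Fin d) ℂ :=
  Matrix.vecMulVec v (star v)

section Aux
variable {d : ℕ}

/-- `vv* · ww* = ⟨v,w⟩ v w*`. -/
lemma aux_mul (a b x y : Fin d → ℂ) :
    vecMulVec a b * vecMulVec x y = (b ⬝ᵥ x) • vecMulVec a y := by
  rw [Matrix.vecMulVec_mul_vecMulVec]
  ext i j
  simp [vecMulVec_apply, mul_comm, mul_left_comm]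

lemma aux_herm (v : Fin d → ℂ) : (outerProj v)ᴴ = outerProj v := by
  ext i j
  simp [outerProj, vecMulVec_apply, mul_comm]

lemma aux_unit (v : Fin d → ℂ) (hv : ∑ i, ‖v i‖ ^ 2 = 1) : star v ⬝ᵥ v = 1 := by
  have : star v ⬝ᵥ v = ((∑ i, ‖v i‖ ^ 2 : ℝ) : ℂ) := by
    push_cast
    refine Finset.sum_congr rfl fun i _ => ?_
    simp [← Complex.conj_mul']
  rw [this, hv]; simp

lemma aux_trace (a b : Fin d → ℂ) : (vecMulVec a b).trace = b ⬝ᵥ a := by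
  simp [Matrix.trace, vecMulVec_apply, dotProduct, mul_comm]

lemma aux_traceNorm (D : Matrix (Fin d) (Fin d) ℂ) (s : ℝ) (hs : 0 ≤ s) (hD : Dᴴ = D)
    (h3 : D * D * D = ((s ^ 2 : ℝ) : ℂ) • D) (ht2 : (D * D).trace = ((2 * s ^ 2 : ℝ) : ℂ)) :
    traceNorm D = 2 * s := by
  have hA := Matrix.posSemidef_conjTranspose_mul_self D
  have htr : traceNorm D = ∑ i, Real.sqrt (hA.1.eigenvalues i) := by
    unfold traceNorm Matrix.PosSemidef.sqrt
    rw [Matrix.trace_mul_cycle]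
    have : (star hA.1.eigenvectorUnitary : Matrix (Fin d) (Fin d) ℂ) *
      (hA.1.eigenvectorUnitary : Matrix (Fin d) (Fin d) ℂ) = 1 := by
      simp
    rw [this, one_mul, Matrix.trace_diagonal]
    simp
  have hAA : (Dᴴ * D) * (Dᴴ * D) = ((s ^ 2 : ℝ) : ℂ) • (Dᴴ * D) := by
    rw [hD, ← Matrix.mul_assoc, h3, Matrix.smul_mul]
  have hev : ∀ i, s * Real.sqrt (hA.1.eigenvalues i) = hA.1.eigenvalues i := by
    intro i
    set l := hA.1.eigenvalues i with hl
    have hl0 : 0 ≤ l := hA.eigenvalues_nonneg i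
    have e1 := hA.1.mulVec_eigenvectorBasis i
    set u := (hA.1.eigenvectorBasis i) with hu
    have hu0 : u ≠ 0 := hA.1.eigenvectorBasis.orthonormal.ne_zero i
    rw [← hl] at e1
    have e2 := congrArg (fun M => M *ᵥ (u : Fin d → ℂ)) hAA
    simp only [← Matrix.mulVec_mulVec, Matrix.smul_mulVec, e1, Matrix.mulVec_smul] at e2
    have hu1 : ∃ j, u j ≠ 0 := by
      by_contra! h
      exact hu0 (by ext j; simpa using h j)
    obtain ⟨j, hj⟩ := hu1
    have e3 := congrFun e2 j
    simp only [Pi.smul_apply, Complex.real_smul, smul_eq_mul, ← mul_assoc] at e3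
    have e4 := mul_right_cancel₀ hj e3
    have e5 : l * l = s ^ 2 * l := by
      apply Complex.ofReal_injective
      push_cast
      simpa using e4
    rcases eq_or_lt_of_le hl0 with h | h
    · rw [← h]; simp
    · have : l = s ^ 2 := mul_right_cancel₀ h.ne' e5
      rw [this, Real.sqrt_sq hs]; ring
  have hsum : s * traceNorm D = 2 * s ^ 2 := by
    rw [htr, Finset.mul_sum, Finset.sum_congr rfl fun i _ => hev i]
    have := hA.1.trace_eq_sum_eigenvalues
    have hDD : (Dᴴ * D).trace = ((2 * s ^ 2 : ℝ) : ℂ) := by rw [hD]; exact ht2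
    rw [hDD] at this
    have h2 := congrArg Complex.re this
    rw [Complex.ofReal_re, Complex.re_sum] at h2
    exact h2.symm
  rcases eq_or_lt_of_le hs with h | h
  · rw [htr]
    rw [← h]
    simp only [mul_zero]
    refine Finset.sum_eq_zero fun i _ => ?_
    have := hev i
    rw [← h] at this
    rw [← this]; simp
  · have : s * traceNorm D = s * (2 * s) := by rw [hsum]; ring
    exact mul_left_cancel₀ h.ne' this

lemma aux_proj_psd (P : Matrix (Fin d) (Fin d) ℂ) (hP : Pᴴ = P) (hPP : P * P = P) :
    P.PosSemidef := by
  have := Matrix.posSemidef_conjTranspose_mul_self P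
  rwa [hP, hPP] at this

lemma aux_trace_nonneg (C P : Matrix (Fin d) (Fin d) ℂ) (hC : C.PosSemidef)
    (hP : Pᴴ = P) (hPP : P * P = P) : 0 ≤ (C * P).trace := by
  have h := (hC.conjTranspose_mul_mul_same P).trace_nonneg
  rwa [hP, Matrix.trace_mul_comm, ← Matrix.mul_assoc, hPP, Matrix.trace_mul_comm] at h

/-- The spectral projection of `D` for the eigenvalue `t = ±s`. -/
noncomputable def auxP (D : Matrix (Fin d) (Fin d) ℂ) (t : ℝ) : Matrix (Fin d) (Fin d) ℂ :=
  ((1 / (2 * t ^ 2) : ℝ) : ℂ) • (D * D + (t : ℂ) • D)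

lemma auxP_herm (D : Matrix (Fin d) (Fin d) ℂ) (t : ℝ) (hD : Dᴴ = D) :
    (auxP D t)ᴴ = auxP D t := by
  simp [auxP, Matrix.conjTranspose_smul, hD]

lemma auxP_idem (D : Matrix (Fin d) (Fin d) ℂ) (t : ℝ) (ht : t ≠ 0)
    (h3 : D * D * D = ((t ^ 2 : ℝ) : ℂ) • D) : auxP D t * auxP D t = auxP D t := by
  have h3' : D * (D * D) = ((t ^ 2 : ℝ) : ℂ) • D := by rw [← Matrix.mul_assoc, h3]
  have h4 : D * D * (D * D) = ((t ^ 2 : ℝ) : ℂ) • (D * D) := by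
    rw [← Matrix.mul_assoc, h3, Matrix.smul_mul]
  have htc : (t : ℂ) ≠ 0 := by exact_mod_cast ht
  simp only [auxP, Matrix.smul_mul, Matrix.mul_smul, Matrix.add_mul, Matrix.mul_add, h3, h3', h4]
  push_cast
  match_scalars <;> field_simp <;> ring

lemma auxP_trace (D : Matrix (Fin d) (Fin d) ℂ) (t : ℝ) (ht : t ≠ 0)
    (ht1 : D.trace = 0) (ht2 : (D * D).trace = ((2 * t ^ 2 : ℝ) : ℂ)) :
    (auxP D t).trace = 1 := by
  have htc : (t : ℂ) ≠ 0 := by exact_mod_cast ht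
  simp only [auxP, Matrix.trace_smul, Matrix.trace_add, ht1, ht2, smul_eq_mul]
  push_cast
  field_simp
  simp

lemma auxP_sub (D : Matrix (Fin d) (Fin d) ℂ) (t : ℝ) (ht : t ≠ 0) :
    D = (t : ℂ) • (auxP D t - auxP D (-t)) := by
  have htc : (t : ℂ) ≠ 0 := by exact_mod_cast ht
  simp only [auxP]
  push_cast
  match_scalars <;> field_simp <;> norm_num

lemma aux_greatest (D : Matrix (Fin d) (Fin d) ℂ) (s : ℝ) (hs : 0 ≤ s) (hD : Dᴴ = D)
    (h3 : D * D * D = ((s ^ 2 : ℝ) : ℂ) • D) (ht1 : D.trace = 0)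
    (ht2 : (D * D).trace = ((2 * s ^ 2 : ℝ) : ℂ)) :
    IsGreatest {r : ℝ | ∃ C : Matrix (Fin d) (Fin d) ℂ,
        C.PosSemidef ∧ (1 - C).PosSemidef ∧ r = ‖(C * D).trace‖} s := by
  rcases eq_or_lt_of_le hs with h | h
  · have hD0 : D = 0 := by
      rw [← Matrix.trace_conjTranspose_mul_self_eq_zero_iff, hD, ht2, ← h]; simp
    subst hD0
    constructor
    · exact ⟨0, Matrix.PosSemidef.zero, by simpa using Matrix.PosSemidef.one, by simp [← h]⟩
    · rintro r ⟨C, -, -, rfl⟩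
      simp [← h]
  · have hn : -s ≠ 0 := by linarith
    have h3n : D * D * D = (((-s) ^ 2 : ℝ) : ℂ) • D := by rw [neg_sq]; exact h3
    have ht2n : (D * D).trace = ((2 * (-s) ^ 2 : ℝ) : ℂ) := by rw [neg_sq]; exact ht2
    have hsc : (s : ℂ) ≠ 0 := by exact_mod_cast h.ne'
    constructor
    · have hi := auxP_idem D s h.ne' h3
      refine ⟨auxP D s, aux_proj_psd _ (auxP_herm D s hD) hi, aux_proj_psd _ ?_ ?_, ?_⟩
      · rw [Matrix.conjTranspose_sub, auxP_herm D s hD, Matrix.conjTranspose_one]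
      · simp [Matrix.sub_mul, Matrix.mul_sub, hi]
      · have : (auxP D s * D).trace = s := by
          simp only [auxP, Matrix.smul_mul, Matrix.add_mul, h3, Matrix.trace_smul,
            Matrix.trace_add, ht1, ht2, smul_eq_mul]
          push_cast
          field_simp
          simp
        rw [this]; simp [abs_of_pos h]
    · rintro r ⟨C, hC, hC', rfl⟩
      have key : ∀ t : ℝ, t ≠ 0 → D * D * D = ((t ^ 2 : ℝ) : ℂ) • D →
          (D * D).trace = ((2 * t ^ 2 : ℝ) : ℂ) →
          ∃ a : ℝ, (C * auxP D t).trace = a ∧ 0 ≤ a ∧ a ≤ 1 := by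
        intro t ht h3 ht2
        have p1 := aux_trace_nonneg C _ hC (auxP_herm D t hD) (auxP_idem D t ht h3)
        have p2 := aux_trace_nonneg _ _ hC' (auxP_herm D t hD) (auxP_idem D t ht h3)
        rw [Matrix.sub_mul, Matrix.one_mul, Matrix.trace_sub, auxP_trace D t ht ht1 ht2] at p2
        rw [Complex.nonneg_iff] at p1 p2
        refine ⟨(C * auxP D t).trace.re, ?_, p1.1, ?_⟩
        · apply Complex.ext <;> simp [← p1.2]
        · have := p2.1
          simp at this
          exact this
      obtain ⟨a, ha, ha0, ha1⟩ := key s h.ne' h3 ht2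
      obtain ⟨b, hb, hb0, hb1⟩ := key (-s) hn h3n ht2n
      have : (C * D).trace = ((s * (a - b) : ℝ) : ℂ) := by
        conv_lhs => rw [auxP_sub D s h.ne']
        rw [Matrix.mul_smul, Matrix.mul_sub, Matrix.trace_smul, Matrix.trace_sub, ha, hb]
        simp
      rw [this, Complex.norm_real, Real.norm_eq_abs, abs_mul, abs_of_pos h]
      have : |a - b| ≤ 1 := by rw [abs_le]; constructor <;> linarith
      nlinarith

end Aux

/-- For unit vectors `v, w ∈ ℂ^d`, the maximum of `|Tr(C(vv* − ww*))|` over matrices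
`0 ≼ C ≼ I` equals `(1/2)·‖vv* − ww*‖₁`, which in turn equals `√(1 − |⟨v,w⟩|²)`. -/
theorem max_trace_against_projection_difference (d : ℕ) (v w : Fin d → ℂ)
    (hv : ∑ i, ‖v i‖ ^ 2 = 1) (hw : ∑ i, ‖w i‖ ^ 2 = 1) :
    IsGreatest {r : ℝ | ∃ C : Matrix (Fin d) (Fin d) ℂ,
        C.PosSemidef ∧ (1 - C).PosSemidef ∧
        r = ‖(C * (outerProj v - outerProj w)).trace‖}
      ((1 / 2) * traceNorm (outerProj v - outerProj w)) ∧
    (1 / 2) * traceNorm (outerProj v - outerProj w) =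
      Real.sqrt (1 - ‖star v ⬝ᵥ w‖ ^ 2) := by
  have hvv := aux_unit v hv
  have hww := aux_unit w hw
  have hwv : star w ⬝ᵥ v = star (star v ⬝ᵥ w) := by
    simp [dotProduct, mul_comm]
  have hcc : star (star v ⬝ᵥ w) * (star v ⬝ᵥ w) = ((‖star v ⬝ᵥ w‖ ^ 2 : ℝ) : ℂ) := by
    rw [Complex.star_def, Complex.conj_mul']; simp
  set c := star v ⬝ᵥ w with hc
  set D := outerProj v - outerProj w with hDdef
  have hD : Dᴴ = D := by rw [hDdef, Matrix.conjTranspose_sub, aux_herm, aux_herm]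
  have hD2 : D * D = vecMulVec v (star v) + vecMulVec w (star w) - c • vecMulVec v (star w)
      - star c • vecMulVec w (star v) := by
    simp only [hDdef, outerProj, Matrix.sub_mul, Matrix.mul_sub, aux_mul, hvv, hww, hwv, ← hc]
    module
  have h3 : D * D * D = ((1 - ‖c‖ ^ 2 : ℝ) : ℂ) • D := by
    rw [hD2]
    rw [Complex.ofReal_sub, ← hcc]
    simp only [hDdef, outerProj, Matrix.sub_mul, Matrix.add_mul, Matrix.mul_sub, Matrix.smul_mul,
      aux_mul, hvv, hww, hwv, ← hc]
    push_cast
    module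
  have ht1 : D.trace = 0 := by
    rw [hDdef, Matrix.trace_sub, outerProj, outerProj, aux_trace, aux_trace, hvv, hww, sub_self]
  have ht2 : (D * D).trace = ((2 * (1 - ‖c‖ ^ 2) : ℝ) : ℂ) := by
    rw [hD2, Complex.ofReal_mul, Complex.ofReal_sub, ← hcc]
    simp only [Matrix.trace_sub, Matrix.trace_add, Matrix.trace_smul, aux_trace, hvv, hww, hwv,
      ← hc, smul_eq_mul]
    push_cast
    ring
  have hnn : 0 ≤ 1 - ‖c‖ ^ 2 := by
    have := (Matrix.posSemidef_conjTranspose_mul_self D).trace_nonneg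
    rw [hD, ht2] at this
    have : (0 : ℝ) ≤ 2 * (1 - ‖c‖ ^ 2) := by exact_mod_cast this
    linarith
  have hs := Real.sqrt_nonneg (1 - ‖c‖ ^ 2)
  rw [← Real.sq_sqrt hnn] at h3 ht2
  have hT := aux_traceNorm D _ hs hD h3 ht2
  have hE : (1 / 2) * traceNorm D = Real.sqrt (1 - ‖c‖ ^ 2) := by rw [hT]; ring
  refine ⟨?_, hE⟩
  rw [hE]
  exact aux_greatest D _ hs hD h3 ht1 ht2
end

section
/- Let n ≥ 1 and let C be a 2^n × 2^n complex matrix with 0 ≼ C ≼ I. Then for every unit vector ψ ∈ ℂ^{2^n} there exists a nonempty subset S ⊆ {1, …, 2^n} such that ⟨S, C S⟩ ≥ ⟨ψ, C ψ⟩ − 1 + 1/(128 · (n + 3)). In particular, if some unit vector ψ satisfies ⟨ψ, C ψ⟩ ≥ 1 − ε, then some subset state |S⟩ satisfies ⟨S, C S⟩ ≥ 1/(128 · (n + 3)) − ε. -/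
open scoped BigOperators ComplexOrder
open Matrix

lemma aux_sum_sq {ι : Type*} [DecidableEq ι] (u : ι → ℝ) (M : ℝ) (k : ℕ) :
    ∀ T : Finset ι, T.card = k → (∀ i ∈ T, 0 ≤ u i) →
      (∀ S ⊆ T, (∑ i ∈ S, u i) ^ 2 ≤ M * S.card) →
      ∑ i ∈ T, u i ^ 2 ≤ M * ((harmonic k : ℚ) : ℝ) := by
  induction k with
  | zero =>
    intro T hT _ _
    rw [Finset.card_eq_zero] at hT
    simp [hT]
  | succ k ih =>
    intro T hT h0 hS
    have hne : T.Nonempty := by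
      rw [← Finset.card_pos]; omega
    obtain ⟨m, hm, hmin⟩ := Finset.exists_min_image T u hne
    have h1 := ih (T.erase m) (by rw [Finset.card_erase_of_mem hm, hT]; rfl)
      (fun i hi => h0 i (Finset.mem_of_mem_erase hi))
      (fun S hST => hS S (hST.trans (Finset.erase_subset _ _)))
    rw [← Finset.add_sum_erase T _ hm, harmonic_succ]
    have h2 : ((k : ℝ) + 1) * u m ≤ ∑ i ∈ T, u i := by
      have := Finset.card_nsmul_le_sum T u (u m) hmin
      rw [hT] at this
      simpa using this
    have h3 := hS T (Finset.Subset.refl _)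
    rw [hT] at h3
    push_cast at h3 ⊢
    have hk : (0 : ℝ) < (k : ℝ) + 1 := by positivity
    have h4 : (((k : ℝ) + 1) * u m) ^ 2 ≤ M * (k + 1) :=
      le_trans (pow_le_pow_left₀ (mul_nonneg hk.le (h0 m hm)) h2 2) h3
    have h5 : u m ^ 2 ≤ M * ((k : ℝ) + 1)⁻¹ := by
      rw [← div_eq_mul_inv, le_div_iff₀ hk]
      have : (u m ^ 2 * (k + 1)) * ((k : ℝ) + 1) ≤ M * (k + 1) := by nlinarith
      exact le_of_mul_le_mul_right this hk
    rw [mul_add]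
    linarith

lemma aux_harmonic (n k : ℕ) (h : k ≤ 2 ^ n) : ((harmonic k : ℚ) : ℝ) ≤ n + 1 := by
  have h1 := harmonic_le_one_add_log k
  have h2 : Real.log k ≤ n := by
    rcases Nat.eq_zero_or_pos k with rfl | hk
    · simp
    · have : Real.log k ≤ Real.log ((2 : ℝ) ^ n) := by
        apply Real.log_le_log (by exact_mod_cast hk)
        exact_mod_cast h
      rw [Real.log_pow] at this
      have l2 := Real.log_two_lt_d9
      have hn : (0 : ℝ) ≤ n := by positivity
      nlinarith
  linarith

lemma aux_signed (n : ℕ) (v : Fin (2 ^ n) → ℝ) (M : ℝ) (hM : 0 ≤ M)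
    (hS : ∀ S : Finset (Fin (2 ^ n)), (∑ i ∈ S, v i) ^ 2 ≤ M * S.card) :
    ∑ i, v i ^ 2 ≤ 2 * (M * (n + 1)) := by
  rw [← Finset.sum_filter_add_sum_filter_not Finset.univ (fun i => 0 ≤ v i)]
  have card_le : ∀ T : Finset (Fin (2 ^ n)), T.card ≤ 2 ^ n := fun T => by
    simpa using Finset.card_le_univ T
  have h1 := aux_sum_sq v M _ (Finset.univ.filter (fun i => 0 ≤ v i)) rfl
    (fun i hi => (Finset.mem_filter.1 hi).2) (fun S _ => hS S)
  have h2 := aux_sum_sq (fun i => - v i) M _ (Finset.univ.filter (fun i => ¬ 0 ≤ v i)) rfl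
    (fun i hi => by have := (Finset.mem_filter.1 hi).2; linarith)
    (fun S _ => by simpa using hS S)
  simp only [neg_sq] at h2
  have h3 := mul_le_mul_of_nonneg_left
    (aux_harmonic n _ (card_le (Finset.univ.filter (fun i => 0 ≤ v i)))) hM
  have h4 := mul_le_mul_of_nonneg_left
    (aux_harmonic n _ (card_le (Finset.univ.filter (fun i => ¬ 0 ≤ v i)))) hM
  linarith

lemma aux_exists (n : ℕ) (ψ : Fin (2 ^ n) → ℂ) (hψ : ∑ i, ‖ψ i‖ ^ 2 = 1) :
    ∃ S : Finset (Fin (2 ^ n)), S.Nonempty ∧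
      1 / (8 * ((n : ℝ) + 1)) * S.card ≤ ‖∑ i ∈ S, ψ i‖ ^ 2 := by
  by_contra! hcon
  set M : ℝ := 1 / (8 * ((n : ℝ) + 1)) with hMdef
  have hM : 0 ≤ M := by positivity
  have hall : ∀ S : Finset (Fin (2 ^ n)), ‖∑ i ∈ S, ψ i‖ ^ 2 ≤ M * S.card := by
    intro S
    rcases S.eq_empty_or_nonempty with rfl | h
    · simp
    · exact (hcon S h).le
  have hsq : ∀ z : ℂ, ‖z‖ ^ 2 = z.re ^ 2 + z.im ^ 2 := by
    intro z
    rw [Complex.sq_norm, Complex.normSq_apply]; ring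
  have hre := aux_signed n (fun i => (ψ i).re) M hM (fun S => by
    have := hall S
    rw [hsq, Complex.re_sum, Complex.im_sum] at this
    nlinarith [sq_nonneg (∑ i ∈ S, (ψ i).im)])
  have him := aux_signed n (fun i => (ψ i).im) M hM (fun S => by
    have := hall S
    rw [hsq, Complex.re_sum, Complex.im_sum] at this
    nlinarith [sq_nonneg (∑ i ∈ S, (ψ i).re)])
  simp only [hsq, Finset.sum_add_distrib] at hψ
  have hMn : M * ((n : ℝ) + 1) = 1 / 8 := by
    rw [hMdef]; field_simp
  linarith

lemma aux_form {d : ℕ} (A : Matrix (Fin d) (Fin d) ℂ) (hA : A.PosSemidef)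
    (x y : Fin d → ℂ) (t : ℝ) :
    2 * t * (star x ⬝ᵥ A.mulVec y).re ≤
      t ^ 2 * (star x ⬝ᵥ A.mulVec x).re + (star y ⬝ᵥ A.mulVec y).re := by
  have h0 := hA.re_dotProduct_nonneg ((t : ℂ) • x - y)
  have hsym : (star y ⬝ᵥ A.mulVec x).re = (star x ⬝ᵥ A.mulVec y).re := by
    have : star (star x ⬝ᵥ A.mulVec y) = star y ⬝ᵥ A.mulVec x := by
      rw [Matrix.star_dotProduct, star_star, Matrix.star_mulVec, hA.1.eq,
        ← Matrix.dotProduct_mulVec]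
    rw [← this]; simp
  simp only [star_sub, star_smul, Matrix.mulVec_sub, Matrix.mulVec_smul, sub_dotProduct,
    dotProduct_sub, smul_dotProduct, dotProduct_smul] at h0
  simp [hsym] at h0
  nlinarith

lemma aux_main {d : ℕ} (C : Matrix (Fin d) (Fin d) ℂ)
    (hC : C.PosSemidef) (hIC : (1 - C).PosSemidef) (φ ψ : Fin d → ℂ)
    (hφ : star φ ⬝ᵥ φ = 1) (hψ : star ψ ⬝ᵥ ψ = 1) (τ : ℝ) (hτ : 0 < τ)
    (hγ : 4 * τ ≤ Complex.normSq (star φ ⬝ᵥ ψ)) :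
    (star ψ ⬝ᵥ C.mulVec ψ).re - 1 + τ ≤ (star φ ⬝ᵥ C.mulVec φ).re := by
  set c := star φ ⬝ᵥ ψ with hc
  set a := (star ψ ⬝ᵥ C.mulVec ψ).re with ha
  set p := (star φ ⬝ᵥ C.mulVec φ).re with hp
  set γ := Complex.normSq c with hγd
  set y : Fin d → ℂ := (star c / 2) • ψ with hy
  have hp0 : 0 ≤ p := hC.re_dotProduct_nonneg φ
  have ha0 : 0 ≤ a := hC.re_dotProduct_nonneg ψ
  have hIre : ∀ x z : Fin d → ℂ, (star x ⬝ᵥ (1 - C).mulVec z).re =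
      (star x ⬝ᵥ z).re - (star x ⬝ᵥ C.mulVec z).re := by
    intro x z
    rw [Matrix.sub_mulVec, Matrix.one_mulVec, dotProduct_sub, Complex.sub_re]
  have ha1 : 0 ≤ 1 - a := by
    have := hIC.re_dotProduct_nonneg ψ
    have h2 := hIre ψ ψ
    rw [hψ] at h2
    simp only [Complex.one_re] at h2
    change 0 ≤ (star ψ ⬝ᵥ (1 - C).mulVec ψ).re at this
    linarith
  have hyy : ∀ A : Matrix (Fin d) (Fin d) ℂ,
      (star y ⬝ᵥ A.mulVec y).re = γ / 4 * (star ψ ⬝ᵥ A.mulVec ψ).re := by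
    intro A
    have h1 : star y ⬝ᵥ A.mulVec y = ((γ / 4 : ℝ) : ℂ) * (star ψ ⬝ᵥ A.mulVec ψ) := by
      have h2 : (c / 2) * (star c / 2) = ((γ / 4 : ℝ) : ℂ) := by
        have := Complex.mul_conj c
        push_cast
        rw [hγd, ← this]
        simp only [Complex.star_def]
        ring
      rw [← h2, hy, star_smul, Matrix.mulVec_smul, smul_dotProduct, dotProduct_smul]
      simp
      ring
    rw [h1, Complex.re_ofReal_mul]
  have hφy : (star φ ⬝ᵥ y).re = γ / 2 := by
    have h1 : star φ ⬝ᵥ y = ((γ / 2 : ℝ) : ℂ) := by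
      have := Complex.mul_conj c
      rw [hy, dotProduct_smul, ← hc]
      push_cast
      rw [hγd, ← this]
      simp only [Complex.star_def, smul_eq_mul]
      ring
    rw [h1, Complex.ofReal_re]
  have f1 := aux_form C hC φ y 1
  set t := 1 - a + τ with ht
  have htpos : 0 < t := by linarith
  have f2 := aux_form (1 - C) hIC φ y t
  rw [hyy] at f1 f2
  rw [hIre, hIre, hIre, hφ, hψ, hφy] at f2
  simp only [Complex.one_re] at f2
  rw [← ha, ← hp] at f1 f2
  have hγ0 : 0 ≤ γ := Complex.normSq_nonneg _
  set w := (star φ ⬝ᵥ C.mulVec y).re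
  have f3 : t * (2 * (γ / 2 - w)) ≤ t * (t + γ / 4) := by
    have e1 : γ / 4 * (1 - a) ≤ γ / 4 * t := mul_le_mul_of_nonneg_left (by linarith) (by linarith)
    have e2 : 0 ≤ t ^ 2 * p := by positivity
    nlinarith
  have f4 := le_of_mul_le_mul_left f3 htpos
  have f5 : γ / 4 * a ≤ γ / 4 := by nlinarith
  linarith

lemma aux_first (n : ℕ)
    (C : Matrix (Fin (2 ^ n)) (Fin (2 ^ n)) ℂ)
    (hC : C.PosSemidef) (hIC : (1 - C).PosSemidef)
    (ψ : Fin (2 ^ n) → ℂ) (hψ : ∑ i, ‖ψ i‖ ^ 2 = 1) :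
    ∃ S : Finset (Fin (2 ^ n)), S.Nonempty ∧
        (star (subsetState S) ⬝ᵥ C.mulVec (subsetState S)).re ≥
          (star ψ ⬝ᵥ C.mulVec ψ).re - 1 + 1 / (128 * (n + 3)) := by
  obtain ⟨S, hS, hb⟩ := aux_exists n ψ hψ
  refine ⟨S, hS, ?_⟩
  have hcard : (0 : ℝ) < S.card := by exact_mod_cast hS.card_pos
  have hin : ∀ x : Fin (2 ^ n) → ℂ, star (subsetState S) ⬝ᵥ x =
      ((1 / Real.sqrt S.card : ℝ) : ℂ) * ∑ i ∈ S, x i := by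
    intro x
    simp only [dotProduct, subsetState, Pi.star_apply, Finset.mul_sum]
    rw [← Finset.sum_subset (Finset.subset_univ S)]
    · refine Finset.sum_congr rfl (fun i hi => ?_)
      rw [if_pos hi, Complex.star_def, Complex.conj_ofReal]
    · intro i _ hi
      rw [if_neg hi]; simp
  have hs : (1 / Real.sqrt S.card) * (1 / Real.sqrt S.card) = 1 / (S.card : ℝ) := by
    rw [div_mul_div_comm, Real.mul_self_sqrt hcard.le, one_mul]
  apply aux_main C hC hIC
  · rw [hin]
    have : ∑ i ∈ S, subsetState S i = ∑ i ∈ S, ((1 / Real.sqrt S.card : ℝ) : ℂ) :=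
      Finset.sum_congr rfl (fun i hi => by simp only [subsetState, if_pos hi])
    rw [this, Finset.sum_const, nsmul_eq_mul, mul_left_comm, ← Complex.ofReal_mul, hs]
    have hc : (S.card : ℂ) ≠ 0 := by exact_mod_cast hS.card_pos.ne'
    push_cast
    field_simp
  · have : star ψ ⬝ᵥ ψ = ((∑ i, ‖ψ i‖ ^ 2 : ℝ) : ℂ) := by
      simp only [dotProduct, Pi.star_apply, Complex.star_def, Complex.conj_mul']
      push_cast
      rfl
    rw [this, hψ]; simp
  · positivity
  · rw [hin, Complex.normSq_mul, Complex.normSq_ofReal, hs, ← Complex.sq_norm]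
    have h1 : 1 / (8 * ((n : ℝ) + 1)) ≤ 1 / (S.card : ℝ) * ‖∑ i ∈ S, ψ i‖ ^ 2 := by
      rw [one_div_mul_eq_div, le_div_iff₀ hcard]; exact hb
    refine le_trans ?_ h1
    rw [mul_one_div, div_le_div_iff₀ (by positivity) (by positivity)]
    have : (0 : ℝ) ≤ n := by positivity
    nlinarith

/-- If `0 ≼ C ≼ I` acts on `n` qubits, then for every unit vector `ψ` some subset
state `|S⟩` satisfies `⟨S, C S⟩ ≥ ⟨ψ, C ψ⟩ − 1 + 1/(128(n+3))`.  In particular, if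
`⟨ψ, C ψ⟩ ≥ 1 − ε` for some `ε`, then some subset state satisfies
`⟨S, C S⟩ ≥ 1/(128(n+3)) − ε`. -/
theorem subset_state_accepts (n : ℕ) (hn : 1 ≤ n)
    (C : Matrix (Fin (2 ^ n)) (Fin (2 ^ n)) ℂ)
    (hC : C.PosSemidef) (hIC : (1 - C).PosSemidef)
    (ψ : Fin (2 ^ n) → ℂ) (hψ : ∑ i, ‖ψ i‖ ^ 2 = 1) :
    (∃ S : Finset (Fin (2 ^ n)), S.Nonempty ∧
        (star (subsetState S) ⬝ᵥ C.mulVec (subsetState S)).re ≥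
          (star ψ ⬝ᵥ C.mulVec ψ).re - 1 + 1 / (128 * (n + 3))) ∧
    ∀ ε : ℝ, (star ψ ⬝ᵥ C.mulVec ψ).re ≥ 1 - ε →
      ∃ S : Finset (Fin (2 ^ n)), S.Nonempty ∧
        (star (subsetState S) ⬝ᵥ C.mulVec (subsetState S)).re ≥
          1 / (128 * (n + 3)) - ε := by
  refine ⟨aux_first n C hC hIC ψ hψ, fun ε hε => ?_⟩
  obtain ⟨S, hS, h⟩ := aux_first n C hC hIC ψ hψ
  exact ⟨S, hS, by linarith⟩
end

section
/- Let m ≥ 1, let M be a 2^m × 2^m complex matrix with 0 ≼ M ≼ I, and let α ≥ 0. Suppose that for every nonempty subset S ⊆ {1, …, 2^m}, the subset state satisfies ⟨S, M S⟩ ≤ α. Then for every unit vector ψ ∈ ℂ^{2^m}, ⟨ψ, M ψ⟩ ≤ 1 + α − 1/(128 · (m + 3)). -/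
open scoped BigOperators ComplexOrder
open Matrix

lemma sss_expand {n : ℕ} (M : Matrix (Fin n) (Fin n) ℂ) (x y : Fin n → ℂ) (a b : ℝ) :
    (star ((a : ℂ) • x + (b : ℂ) • y) ⬝ᵥ M *ᵥ ((a : ℂ) • x + (b : ℂ) • y)).re =
      a ^ 2 * (star x ⬝ᵥ M *ᵥ x).re + b ^ 2 * (star y ⬝ᵥ M *ᵥ y).re
      + a * b * ((star x ⬝ᵥ M *ᵥ y).re + (star y ⬝ᵥ M *ᵥ x).re) := by
  simp only [star_add, star_smul, mulVec_add, mulVec_smul, add_dotProduct, dotProduct_add,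
    smul_dotProduct, dotProduct_smul, smul_eq_mul, Complex.add_re, RCLike.star_def,
    Complex.conj_ofReal, Complex.re_ofReal_mul]
  ring

lemma sss_core {n : ℕ} (M : Matrix (Fin n) (Fin n) ℂ)
    (hM : M.PosSemidef) (hIM : (1 - M).PosSemidef) (x y : Fin n → ℂ) (t : ℝ)
    (ht0 : 0 < t) (ht1 : t < 1)
    (hx : (star x ⬝ᵥ x).re = 1) (hy : (star y ⬝ᵥ y).re = 1)
    (hxy : 2 * t ≤ (star x ⬝ᵥ y).re + (star y ⬝ᵥ x).re) :
    (star x ⬝ᵥ M *ᵥ x).re ≤ (star y ⬝ᵥ M *ᵥ y).re + 1 - t ^ 2 / 2 := by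
  have h1 := (Complex.le_def.1 (hIM.dotProduct_mulVec_nonneg
    (((2 - t : ℝ) : ℂ) • x + ((-t : ℝ) : ℂ) • y))).1
  have h2 := (Complex.le_def.1 (hM.dotProduct_mulVec_nonneg
    (((t : ℝ) : ℂ) • x + ((-(2 - t) : ℝ) : ℂ) • y))).1
  rw [sss_expand] at h1 h2
  simp only [sub_mulVec, one_mulVec, dotProduct_sub, Complex.sub_re, Complex.zero_re, hx, hy] at h1 h2
  have h3 : 0 ≤ t * (2 - t) * ((star x ⬝ᵥ y).re + (star y ⬝ᵥ x).re - 2 * t) :=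
    mul_nonneg (mul_nonneg ht0.le (by linarith)) (by linarith)
  have h4 : 0 < 4 * (1 - t) := by linarith
  refine le_of_mul_le_mul_left ?_ h4
  nlinarith

lemma sss_harm {ι : Type*} [DecidableEq ι] (a : ι → ℝ) (B : ℝ) (k : ℕ) :
    ∀ T : Finset ι, T.card = k → (∀ i ∈ T, 0 ≤ a i) →
    (∀ S ⊆ T, (∑ i ∈ S, a i) ^ 2 ≤ B * S.card) →
    ∑ i ∈ T, a i ^ 2 ≤ B * (harmonic k : ℝ) := by
  induction k with
  | zero =>
    intro T hT _ _
    rw [Finset.card_eq_zero] at hT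
    simp [hT]
  | succ k ih =>
    intro T hT ha hB
    have hne : T.Nonempty := by rw [← Finset.card_pos]; omega
    obtain ⟨i, hi, hmin⟩ := Finset.exists_min_image T a hne
    have h1 := ih (T.erase i) (by rw [Finset.card_erase_of_mem hi]; omega)
      (fun j hj => ha j (Finset.mem_of_mem_erase hj))
      (fun S hS => hB S (hS.trans (Finset.erase_subset _ _)))
    have h2 : (k + 1 : ℝ) * a i ≤ ∑ j ∈ T, a j := by
      have := Finset.card_nsmul_le_sum T a (a i) hmin
      rw [hT] at this
      simpa using this
    have h3 := hB T subset_rfl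
    rw [hT] at h3
    push_cast at h3
    have hk : (0 : ℝ) < k + 1 := by positivity
    have h4 : ((k + 1 : ℝ) * a i) ^ 2 ≤ B * (k + 1) :=
      le_trans (pow_le_pow_left₀ (mul_nonneg hk.le (ha i hi)) h2 2) h3
    have h5 : a i ^ 2 ≤ B * (k + 1 : ℝ)⁻¹ := by
      rw [← div_eq_mul_inv, le_div_iff₀ hk]
      refine le_of_mul_le_mul_left ?_ hk
      nlinarith
    rw [← Finset.add_sum_erase T _ hi, harmonic_succ]
    push_cast
    nlinarith

lemma sss_find (m : ℕ) (r : Fin (2 ^ m) → ℝ) (t : ℝ) (ht0 : 0 < t)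
    (ht : t ^ 2 = 1 / (64 * (m + 3)))
    (hr : 1 / 4 ≤ ∑ i, (max (r i) 0) ^ 2) :
    ∃ S : Finset (Fin (2 ^ m)), S.Nonempty ∧ t * Real.sqrt S.card ≤ ∑ i ∈ S, r i := by
  by_contra! hcon
  have h := sss_harm r (t ^ 2) _ (Finset.univ.filter (fun i => 0 ≤ r i)) rfl
    (by simp) (by
      intro S hS
      have hnn : 0 ≤ ∑ i ∈ S, r i := Finset.sum_nonneg (fun i hi => by simpa using hS hi)
      rcases S.eq_empty_or_nonempty with rfl | hne
      · simp
      · have := pow_le_pow_left₀ hnn (hcon S hne).le 2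
        rwa [mul_pow, Real.sq_sqrt (Nat.cast_nonneg _)] at this)
  set k := (Finset.univ.filter (fun i => 0 ≤ r i)).card with hk
  have hkle : k ≤ 2 ^ m := by
    refine (Finset.card_le_univ _).trans ?_
    simp
  have hs : ∑ i, (max (r i) 0) ^ 2 = ∑ i ∈ Finset.univ.filter (fun i => 0 ≤ r i), r i ^ 2 := by
    rw [Finset.sum_filter]
    refine Finset.sum_congr rfl fun i _ => ?_
    split_ifs with h0
    · rw [max_eq_left h0]
    · rw [max_eq_right (not_le.1 h0).le]; simp
  have hharm : (harmonic k : ℝ) ≤ 1 + m := by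
    refine (harmonic_le_one_add_log k).trans ?_
    have : Real.log k ≤ m := by
      rcases Nat.eq_zero_or_pos k with h0 | h0
      · rw [h0]; simp
      · calc Real.log k ≤ Real.log ((2 : ℝ) ^ m) :=
              Real.log_le_log (by exact_mod_cast h0) (by exact_mod_cast hkle)
          _ = m * Real.log 2 := by rw [Real.log_pow]
          _ ≤ m * 1 := by
              gcongr
              linarith [Real.log_two_lt_d9]
          _ = m := by ring
    linarith
  have hmm : t ^ 2 * (1 + m) ≤ 1 / 64 := by
    rw [ht, div_mul_eq_mul_div, div_le_div_iff₀ (by positivity) (by norm_num)]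
    nlinarith
  have := mul_le_mul_of_nonneg_left hharm (sq_nonneg t)
  linarith

lemma sss_norm {n : ℕ} (x : Fin n → ℂ) : (star x ⬝ᵥ x).re = ∑ i, ‖x i‖ ^ 2 := by
  simp [dotProduct, ← Complex.normSq_eq_norm_sq, Complex.normSq_apply]

/-- Soundness against arbitrary witnesses from soundness against subset states: if
`0 ≼ M ≼ I` on `m` qubits satisfies `⟨S, M S⟩ ≤ α` for every subset state, then every
unit vector `ψ` satisfies `⟨ψ, M ψ⟩ ≤ 1 + α − 1/(128(m+3))`. -/
theorem soundness_from_subset_states (m : ℕ) (hm : 1 ≤ m)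
    (M : Matrix (Fin (2 ^ m)) (Fin (2 ^ m)) ℂ)
    (hM : M.PosSemidef) (hIM : (1 - M).PosSemidef)
    (α : ℝ) (hα : 0 ≤ α)
    (hsub : ∀ S : Finset (Fin (2 ^ m)), S.Nonempty →
      (star (subsetState S) ⬝ᵥ M.mulVec (subsetState S)).re ≤ α)
    (ψ : Fin (2 ^ m) → ℂ) (hψ : ∑ i, ‖ψ i‖ ^ 2 = 1) :
    (star ψ ⬝ᵥ M.mulVec ψ).re ≤ 1 + α - 1 / (128 * (m + 3)) := by
  obtain ⟨t, ht0, ht⟩ : ∃ t : ℝ, 0 < t ∧ t ^ 2 = 1 / (64 * (m + 3)) :=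
    ⟨Real.sqrt (1 / (64 * (m + 3))), by positivity, Real.sq_sqrt (by positivity)⟩
  have ht1 : t < 1 := by
    have : t ^ 2 < 1 := by
      rw [ht, div_lt_one (by positivity)]
      have : (0 : ℝ) ≤ m := Nat.cast_nonneg m
      linarith
    nlinarith
  have key : ∀ c : ℂ, star c * c = 1 → 1 / 4 ≤ ∑ i, (max (c * ψ i).re 0) ^ 2 →
      (star ψ ⬝ᵥ M.mulVec ψ).re ≤ 1 + α - 1 / (128 * (m + 3)) := by
    intro c hc hq
    obtain ⟨S, hS, hSt⟩ := sss_find m (fun i => (c * ψ i).re) t ht0 ht hq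
    have hcard : (0 : ℝ) < S.card := by exact_mod_cast hS.card_pos
    have hsq : 0 < Real.sqrt S.card := Real.sqrt_pos.2 hcard
    have hy : (star (subsetState S) ⬝ᵥ subsetState S).re = 1 := by
      rw [sss_norm]
      have : ∀ i, ‖subsetState S i‖ ^ 2 = if i ∈ S then 1 / (S.card : ℝ) else 0 := by
        intro i
        unfold subsetState
        split_ifs
        · rw [Complex.norm_real, Real.norm_eq_abs, sq_abs, div_pow, Real.sq_sqrt hcard.le]
          simp
        · simp
      simp only [this, Finset.sum_ite_mem, Finset.univ_inter, Finset.sum_const, nsmul_eq_mul]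
      field_simp
    have hq2 : ∀ N : Matrix (Fin (2 ^ m)) (Fin (2 ^ m)) ℂ,
        star (c • ψ) ⬝ᵥ N *ᵥ (c • ψ) = star ψ ⬝ᵥ N *ᵥ ψ := by
      intro N
      rw [star_smul, mulVec_smul, smul_dotProduct, dotProduct_smul, smul_smul, hc, one_smul]
    have hx : (star (c • ψ) ⬝ᵥ (c • ψ)).re = 1 := by
      have := hq2 1
      rw [one_mulVec, one_mulVec] at this
      rw [this, sss_norm, hψ]
    have hov : t ≤ (∑ i ∈ S, (c * ψ i).re) / Real.sqrt S.card := by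
      rwa [le_div_iff₀ hsq]
    have e1 : (star (c • ψ) ⬝ᵥ subsetState S).re
        = (∑ i ∈ S, (c * ψ i).re) / Real.sqrt S.card := by
      rw [dotProduct, Complex.re_sum, Finset.sum_div, ← Finset.univ_inter S,
        ← Finset.sum_ite_mem, Finset.univ_inter]
      refine Finset.sum_congr rfl fun i _ => ?_
      unfold subsetState
      split_ifs
      · rw [Complex.re_mul_ofReal]
        simp [div_eq_mul_inv]
      · simp
    have e2 : (star (subsetState S) ⬝ᵥ (c • ψ)).re = (star (c • ψ) ⬝ᵥ subsetState S).re := by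
      simp only [dotProduct, Complex.re_sum]
      refine Finset.sum_congr rfl fun i _ => ?_
      simp
      ring
    have := sss_core M hM hIM (c • ψ) (subsetState S) t ht0 ht1 hx hy (by
      rw [e2, e1]; linarith)
    rw [hq2, ht] at this
    have h5 := hsub S hS
    have h6 : (1 : ℝ) / (64 * (m + 3)) / 2 = 1 / (128 * (m + 3)) := by
      field_simp; norm_num
    linarith
  by_contra hcon
  have k1 := fun h => hcon (key 1 (by simp) h)
  have k2 := fun h => hcon (key (-1) (by simp) h)
  have k3 := fun h => hcon (key Complex.I (by simp) h)
  have k4 := fun h => hcon (key (-Complex.I) (by simp) h)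
  rw [imp_false, not_le] at k1 k2 k3 k4
  have hsum : ∑ i, ‖ψ i‖ ^ 2 = ∑ i, (max (1 * ψ i).re 0) ^ 2 + ∑ i, (max (-1 * ψ i).re 0) ^ 2
      + ∑ i, (max (Complex.I * ψ i).re 0) ^ 2 + ∑ i, (max (-Complex.I * ψ i).re 0) ^ 2 := by
    have hmax : ∀ x : ℝ, max x 0 ^ 2 + max (-x) 0 ^ 2 = x ^ 2 := by
      intro x
      rcases le_total 0 x with h | h
      · rw [max_eq_left h, max_eq_right (by linarith)]; ring
      · rw [max_eq_right h, max_eq_left (by linarith)]; ring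
    simp only [← Finset.sum_add_distrib]
    refine Finset.sum_congr rfl fun i _ => ?_
    have a1 := hmax (ψ i).re
    have a2 := hmax (ψ i).im
    rw [← Complex.normSq_eq_norm_sq, Complex.normSq_apply]
    simp
    linarith
  linarith
end
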